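/- There exists a constant C > 0 such that for every integer m ≠ 0 and every integer n, both of the following quantities are bounded by C/√(1 + m² + n²): (i) 𝓘₁ = (1/|m|)·sup_{0 ≤ s ≤ |m|} K_{n+1}(s)·∫_0^s t·I_n(t) dt, and (ii) 𝓘₂ = (1/|m|)·sup_{0 ≤ t ≤ |m|} I_n(t)·∫_t^{|m|} s·K_{n+1}(s) ds. -/

import Mathlib

open MeasureTheory Real intervalIntegral

/-- Modified Bessel function of the first kind of integer order `n`:
`I_n(t) = (1/π) ∫_0^π exp(t cos α) cos(n α) dα`. -/
noncomputable def besselI (n : ℤ) (t : ℝ) : ℝ :=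
  (1 / Real.pi) * ∫ α in (0:ℝ)..Real.pi, Real.exp (t * Real.cos α) * Real.cos ((n : ℝ) * α)

/-- Modified Bessel function of the second kind of integer order `n`:
`K_n(t) = ∫_0^∞ exp(−t cosh α) cosh(n α) dα`. -/
noncomputable def besselK (n : ℤ) (t : ℝ) : ℝ :=
  ∫ α in Set.Ioi (0:ℝ), Real.exp (-t * Real.cosh α) * Real.cosh ((n : ℝ) * α)

lemma bI_neg (n : ℤ) (t : ℝ) : besselI (-n) t = besselI n t := by
  simp [besselI, Real.cos_neg]

lemma bI_deriv (n : ℤ) (t : ℝ) :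
    HasDerivAt (besselI n) ((besselI (n + 1) t + besselI (n - 1) t) / 2) t := by
  have h := intervalIntegral.hasDerivAt_integral_of_dominated_loc_of_deriv_le
    (μ := volume) (a := 0) (b := Real.pi) (x₀ := t) (s := Metric.ball t 1)
    (F := fun t α => Real.exp (t * Real.cos α) * Real.cos ((n : ℝ) * α))
    (F' := fun t α => Real.exp (t * Real.cos α) * Real.cos α * Real.cos ((n : ℝ) * α))
    (bound := fun _ => Real.exp (|t| + 1))
    (Metric.ball_mem_nhds t one_pos)
    (Filter.Eventually.of_forall fun x => by
      apply Continuous.aestronglyMeasurable; fun_prop)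
    (by apply Continuous.intervalIntegrable; fun_prop)
    (by apply Continuous.aestronglyMeasurable; fun_prop)
    (Filter.Eventually.of_forall fun α _ x hx => by
      rw [norm_mul, norm_mul]
      have h1 : ‖Real.exp (x * Real.cos α)‖ ≤ Real.exp (|t| + 1) := by
        rw [Real.norm_eq_abs, Real.abs_exp, Real.exp_le_exp]
        have hx' : |x| ≤ |t| + 1 := by
          rw [Metric.mem_ball, Real.dist_eq] at hx
          have := abs_sub_abs_le_abs_sub x t
          linarith
        calc x * Real.cos α ≤ |x * Real.cos α| := le_abs_self _
          _ = |x| * |Real.cos α| := abs_mul _ _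
          _ ≤ |x| * 1 := by gcongr; exact Real.abs_cos_le_one α
          _ ≤ _ := by linarith
      have h2 : ‖Real.cos α‖ ≤ 1 := Real.abs_cos_le_one α
      have h3 : ‖Real.cos ((n:ℝ) * α)‖ ≤ 1 := Real.abs_cos_le_one _
      calc _ ≤ Real.exp (|t| + 1) * 1 * 1 := by gcongr
        _ = _ := by ring)
    (by simp)
    (Filter.Eventually.of_forall fun α _ x hx => by
      have := ((hasDerivAt_id x).mul_const (Real.cos α)).exp.mul_const (Real.cos ((n:ℝ) * α))
      simpa using this)
  have h2 := h.2.const_mul (1 / Real.pi)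
  have e : (besselI (n + 1) t + besselI (n - 1) t) / 2 = 1 / Real.pi *
      ∫ α in (0:ℝ)..Real.pi, Real.exp (t * Real.cos α) * Real.cos α * Real.cos ((n : ℝ) * α) := by
    unfold besselI
    rw [← mul_add, ← intervalIntegral.integral_add, mul_div_assoc, ← intervalIntegral.integral_div]
    · congr 1
      apply intervalIntegral.integral_congr
      intro α _
      push_cast
      simp only [add_mul, sub_mul, one_mul, Real.cos_add, Real.cos_sub]
      ring
    · apply Continuous.intervalIntegrable; fun_prop
    · apply Continuous.intervalIntegrable; fun_prop
  rw [e]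
  exact h2

lemma bI_rec (n : ℤ) (t : ℝ) :
    t * (besselI (n - 1) t - besselI (n + 1) t) = 2 * n * besselI n t := by
  have key : ∫ α in (0:ℝ)..Real.pi, (Real.exp (t * Real.cos α) * (t * (-Real.sin α)) * Real.sin (n * α)
      + Real.exp (t * Real.cos α) * (Real.cos (n * α) * n)) = 0 := by
    rw [intervalIntegral.integral_eq_sub_of_hasDerivAt
      (f := fun α => Real.exp (t * Real.cos α) * Real.sin (n * α))]
    · simp [Real.sin_int_mul_pi]
    · intro α _
      have h1 := ((Real.hasDerivAt_cos α).const_mul t).exp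
      have h2 := ((hasDerivAt_id α).const_mul (n:ℝ)).sin
      exact (h1.mul h2).congr_deriv (by simp)
    · apply Continuous.intervalIntegrable; fun_prop
  have e : t * (besselI (n - 1) t - besselI (n + 1) t) - 2 * n * besselI n t =
      -(2 / Real.pi) * ∫ α in (0:ℝ)..Real.pi, (Real.exp (t * Real.cos α) * (t * (-Real.sin α)) * Real.sin (n * α)
      + Real.exp (t * Real.cos α) * (Real.cos (n * α) * n)) := by
    unfold besselI
    simp only [← intervalIntegral.integral_const_mul]
    rw [← intervalIntegral.integral_sub, ← intervalIntegral.integral_const_mul,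
      ← intervalIntegral.integral_sub]
    · apply intervalIntegral.integral_congr
      intro α _
      push_cast
      simp only [add_mul, sub_mul, one_mul, Real.cos_add, Real.cos_sub]
      ring
    all_goals apply Continuous.intervalIntegrable; fun_prop
  rw [key] at e
  linarith

lemma K_bound (t : ℝ) (ht : 0 < t) (a α : ℝ) (hα : 0 ≤ α) :
    Real.exp (-t * Real.cosh α) * Real.exp (a * α) ≤ Real.exp ((a + 1) ^ 2 / t) * Real.exp (-α) := by
  rw [← Real.exp_add, ← Real.exp_add, Real.exp_le_exp]
  have h1 : α ^ 2 / 4 ≤ Real.cosh α := by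
    rw [Real.cosh_eq]
    have := Real.quadratic_le_exp_of_nonneg hα
    have := Real.exp_pos (-α)
    nlinarith
  have h2 : (a + 1) ^ 2 / t - (a + 1) * α + t * (α ^ 2 / 4) = ((a + 1) - t * α / 2) ^ 2 / t := by
    field_simp; ring
  have h3 : 0 ≤ ((a + 1) - t * α / 2) ^ 2 / t := by positivity
  nlinarith [mul_le_mul_of_nonneg_left h1 ht.le]

lemma cosh_le_exp_abs (x : ℝ) : Real.cosh x ≤ Real.exp |x| := by
  rw [← Real.cosh_abs, Real.cosh_eq]
  have : Real.exp (-|x|) ≤ Real.exp |x| := by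
    rw [Real.exp_le_exp]; linarith [abs_nonneg x]
  linarith

lemma K_bound' (t : ℝ) (ht : 0 < t) (a α : ℝ) (hα : 0 ≤ α) :
    Real.exp (-t * Real.cosh α) * Real.cosh (a * α)
      ≤ Real.exp ((|a| + 1) ^ 2 / t) * Real.exp (-α) := by
  refine le_trans ?_ (K_bound t ht |a| α hα)
  gcongr
  have := cosh_le_exp_abs (a * α)
  rwa [abs_mul, abs_of_nonneg hα] at this

lemma K_int (t : ℝ) (ht : 0 < t) (a : ℝ) :
    IntegrableOn (fun α => Real.exp (-t * Real.cosh α) * Real.cosh (a * α)) (Set.Ioi 0) := by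
  refine Integrable.mono' ((integrableOn_exp_neg_Ioi 0).const_mul (Real.exp ((|a| + 1) ^ 2 / t)))
    (by apply Continuous.aestronglyMeasurable; fun_prop) ?_
  refine (ae_restrict_iff' measurableSet_Ioi).2 (Filter.Eventually.of_forall fun α hα => ?_)
  rw [Real.norm_of_nonneg (by positivity)]
  exact K_bound' t ht a α (le_of_lt hα)

lemma bK_nonneg (n : ℤ) (t : ℝ) : 0 ≤ besselK n t := by
  apply MeasureTheory.integral_nonneg
  intro α
  positivity

lemma bK_mono (n m : ℤ) (h : |(n:ℝ)| ≤ |(m:ℝ)|) (t : ℝ) (ht : 0 < t) :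
    besselK n t ≤ besselK m t := by
  apply setIntegral_mono_on (K_int t ht n) (K_int t ht m) measurableSet_Ioi
  intro α hα
  gcongr
  rw [Real.cosh_le_cosh, abs_mul, abs_mul]
  gcongr

lemma bK_exp (n : ℤ) (t s : ℝ) (ht : 0 < t) (h : t ≤ s) :
    besselK n s ≤ Real.exp (-(s - t)) * besselK n t := by
  unfold besselK
  rw [← MeasureTheory.integral_const_mul]
  apply setIntegral_mono_on (K_int s (ht.trans_le h) n) ((K_int t ht n).const_mul _) measurableSet_Ioi
  intro α hα
  rw [← mul_assoc, ← Real.exp_add]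
  gcongr
  nlinarith [Real.one_le_cosh α]

lemma bK_deriv (n : ℤ) (t : ℝ) (ht : 0 < t) :
    HasDerivAt (besselK n) (-(besselK (n + 1) t + besselK (n - 1) t) / 2) t := by
  have hint : IntegrableOn (fun α => Real.exp (-(t/2) * Real.cosh α) * Real.cosh α * Real.cosh ((n : ℝ) * α)) (Set.Ioi 0) := by
    have := ((K_int (t/2) (half_pos ht) (n+1)).add (K_int (t/2) (half_pos ht) (n-1))).const_mul (1/2)
    refine this.congr (Filter.Eventually.of_forall fun α => ?_)
    simp only [Pi.add_apply, add_mul, sub_mul, one_mul, Real.cosh_add, Real.cosh_sub]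
    ring
  have h := hasDerivAt_integral_of_dominated_loc_of_deriv_le
    (μ := volume.restrict (Set.Ioi (0:ℝ))) (x₀ := t) (s := Set.Ioi (t/2))
    (F := fun t α => Real.exp (-t * Real.cosh α) * Real.cosh ((n : ℝ) * α))
    (F' := fun t α => -(Real.exp (-t * Real.cosh α) * Real.cosh α * Real.cosh ((n : ℝ) * α)))
    (bound := fun α => Real.exp (-(t/2) * Real.cosh α) * Real.cosh α * Real.cosh ((n : ℝ) * α))
    (Ioi_mem_nhds (half_lt_self ht))
    (Filter.Eventually.of_forall fun x => by
      apply Continuous.aestronglyMeasurable; fun_prop)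
    (K_int t ht n)
    (by apply Continuous.aestronglyMeasurable; fun_prop)
    (Filter.Eventually.of_forall fun α x hx => by
      rw [norm_neg, Real.norm_of_nonneg (by positivity)]
      have : t / 2 < x := hx
      gcongr)
    hint
    (Filter.Eventually.of_forall fun α x hx => by
      have := ((hasDerivAt_id x).neg.mul_const (Real.cosh α)).exp.mul_const (Real.cosh ((n:ℝ) * α))
      simpa using this)
  have e : -(besselK (n + 1) t + besselK (n - 1) t) / 2 =
      ∫ α in Set.Ioi (0:ℝ), -(Real.exp (-t * Real.cosh α) * Real.cosh α * Real.cosh ((n : ℝ) * α)) := by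
    unfold besselK
    rw [← MeasureTheory.integral_add (K_int t ht _) (K_int t ht _), ← MeasureTheory.integral_neg, ← MeasureTheory.integral_div]
    congr 1
    funext α
    push_cast
    simp only [add_mul, sub_mul, one_mul, Real.cosh_add, Real.cosh_sub]
    ring
  rw [e]
  exact h.2

lemma bK_rec (n : ℤ) (t : ℝ) (ht : 0 < t) :
    t * (besselK (n + 1) t - besselK (n - 1) t) = 2 * n * besselK n t := by
  have hi1 := (K_int t ht n).const_mul (n:ℝ)
  have hi2 := (K_int t ht ((n+1:ℤ):ℝ)).const_mul (t/2)
  have hi3 := (K_int t ht ((n-1:ℤ):ℝ)).const_mul (t/2)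
  have hd : ∀ α : ℝ, HasDerivAt (fun α => Real.exp (-t * Real.cosh α) * Real.sinh (n * α))
      (n * (Real.exp (-t * Real.cosh α) * Real.cosh ((n : ℝ) * α))
      - (t / 2 * (Real.exp (-t * Real.cosh α) * Real.cosh (((n + 1 : ℤ) : ℝ) * α))
        - t / 2 * (Real.exp (-t * Real.cosh α) * Real.cosh (((n - 1 : ℤ) : ℝ) * α)))) α := by
    intro α
    have h1 := ((Real.hasDerivAt_cosh α).const_mul (-t)).exp
    have h2 := ((hasDerivAt_id α).const_mul (n:ℝ)).sinh
    refine (h1.mul h2).congr_deriv ?_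
    push_cast
    simp only [add_mul, sub_mul, one_mul, Real.cosh_add, Real.cosh_sub, id]
    ring
  have key := integral_Ioi_of_hasDerivAt_of_tendsto' (a := 0) (m := 0)
    (fun α _ => hd α) (hi1.sub (hi2.sub hi3)) (by
      have hl : Filter.Tendsto (fun α => Real.exp ((|(n:ℝ)| + 1) ^ 2 / t) * Real.exp (-α))
          Filter.atTop (nhds 0) := by
        simpa using (Real.tendsto_exp_neg_atTop_nhds_zero).const_mul (Real.exp ((|(n:ℝ)| + 1) ^ 2 / t))
      refine squeeze_zero_norm' ?_ hl
      filter_upwards [Filter.eventually_ge_atTop 0] with α hα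
      refine le_trans ?_ (K_bound' t ht n α hα)
      rw [norm_mul, Real.norm_of_nonneg (Real.exp_pos _).le]
      gcongr
      rw [Real.norm_eq_abs, Real.abs_sinh, ← Real.cosh_abs]
      exact (Real.sinh_lt_cosh _).le)
  have e2 := MeasureTheory.integral_sub hi1 (hi2.sub hi3)
  have e3 := MeasureTheory.integral_sub hi2 hi3
  simp only [Pi.sub_apply] at e2 e3
  rw [e2, e3, MeasureTheory.integral_const_mul, MeasureTheory.integral_const_mul,
    MeasureTheory.integral_const_mul] at key
  simp only [mul_zero, Real.sinh_zero, sub_zero] at key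
  change (n:ℝ) * besselK n t - (t / 2 * besselK (n+1) t - t / 2 * besselK (n-1) t) = 0 at key
  linarith

lemma bI_cont (n : ℤ) : Continuous (besselI n) :=
  continuous_iff_continuousAt.2 fun t => (bI_deriv n t).continuousAt

lemma bI_zero_pos (t : ℝ) : 0 < besselI 0 t := by
  unfold besselI
  refine mul_pos (by positivity) ?_
  apply intervalIntegral.intervalIntegral_pos_of_pos
  · apply Continuous.intervalIntegrable; fun_prop
  · intro x; simp; positivity
  · exact Real.pi_pos

lemma mono_tool (f f' : ℝ → ℝ) (hf : ∀ x, HasDerivAt f (f' x) x) (hpos : ∀ x, 0 < x → 0 ≤ f' x)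
    (h0 : f 0 = 0) (t : ℝ) (ht : 0 ≤ t) : 0 ≤ f t := by
  have hm : MonotoneOn f (Set.Ici 0) := by
    apply monotoneOn_of_deriv_nonneg (convex_Ici 0)
    · exact (continuous_iff_continuousAt.2 fun t => (hf t).continuousAt).continuousOn
    · intro x _; exact (hf x).differentiableAt.differentiableWithinAt
    · intro x hx
      rw [interior_Ici] at hx
      rw [(hf x).deriv]; exact hpos x hx
  have := hm (Set.mem_Ici.2 le_rfl) ht ht
  rwa [h0] at this

lemma bI_nonneg (n : ℕ) : ∀ t, 0 ≤ t → 0 ≤ besselI n t := by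
  induction n with
  | zero => intro t _; exact_mod_cast (bI_zero_pos t).le
  | succ n ih =>
    intro t ht
    rcases ht.eq_or_lt with rfl | ht'
    · have := bI_rec ((n+1 : ℕ):ℤ) 0
      have hn : (0:ℝ) < 2 * (((n + 1 : ℕ) : ℤ) : ℝ) := by push_cast; positivity
      rw [zero_mul] at this
      have := mul_eq_zero.1 this.symm
      rcases this with h | h
      · linarith
      · exact h.ge
    have := mono_tool (fun t => t ^ (n+1) * besselI ((n + 1 : ℕ):ℤ) t)
      (fun t => t ^ (n+1) * besselI n t) (fun x => by
        have h := (hasDerivAt_pow (n+1) x).mul (bI_deriv ((n+1 : ℕ):ℤ) x)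
        refine h.congr_deriv ?_
        have r := bI_rec ((n+1 : ℕ):ℤ) x
        push_cast at r ⊢
        simp only [add_sub_cancel_right] at r ⊢
        rw [pow_succ]
        linear_combination (-x ^ n / 2) * r)
      (fun x hx => mul_nonneg (by positivity) (ih x hx.le)) (by simp) t ht
    exact nonneg_of_mul_nonneg_right this (by positivity)

lemma bI_at_zero (n : ℕ) (hn : 1 ≤ n) : besselI n 0 = 0 := by
  have := bI_rec n 0
  rw [zero_mul] at this
  rcases mul_eq_zero.1 this.symm with h | h
  · have : (1:ℝ) ≤ n := by exact_mod_cast hn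
    push_cast at h; linarith
  · exact h

lemma bI_one_le (t : ℝ) : besselI 1 t ≤ besselI 0 t := by
  unfold besselI
  gcongr
  apply intervalIntegral.integral_mono Real.pi_pos.le
  · apply Continuous.intervalIntegrable; fun_prop
  · apply Continuous.intervalIntegrable; fun_prop
  · intro x
    simp only [Int.cast_one, one_mul, Int.cast_zero, zero_mul, Real.cos_zero]
    gcongr
    exact Real.cos_le_one x

lemma bI_anti (n : ℕ) : ∀ t, 0 ≤ t → besselI ((n : ℤ) + 1) t ≤ besselI n t := by
  induction n with
  | zero => intro t _; simpa using bI_one_le t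
  | succ n ih =>
    intro t ht
    rcases ht.eq_or_lt with rfl | ht'
    · have h1 := bI_at_zero (n+1) (by omega)
      have h2 := bI_at_zero (n+2) (by omega)
      push_cast at h1 h2 ⊢
      rw [add_assoc, h1]; exact h2.le
    have := mono_tool (fun t => t ^ (n+1) * (besselI ((n:ℤ) + 1) t - besselI ((n : ℤ) + 2) t))
      (fun t => t ^ (n+1) * (besselI n t - besselI ((n:ℤ) + 1) t) + t ^ n * besselI ((n:ℤ)+2) t)
      (fun x => by
        have h := (hasDerivAt_pow (n+1) x).mul
          ((bI_deriv ((n:ℤ)+1) x).sub (bI_deriv ((n:ℤ)+2) x))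
        refine h.congr_deriv ?_
        have r1 := bI_rec ((n:ℤ)+1) x
        have r2 := bI_rec ((n:ℤ)+2) x
        have e1 : (n:ℤ) + 2 - 1 = n + 1 := by ring
        have e2 : (n:ℤ) + 1 + 1 = n + 2 := by ring
        have e3 : (n:ℤ) + 1 - 1 = n := by ring
        rw [e1] at r2 ⊢
        rw [e2, e3] at r1 ⊢
        push_cast at r1 r2 ⊢
        simp only [Pi.sub_apply]
        rw [pow_succ]
        linear_combination (-x ^ n / 2) * r1 + (x ^ n / 2) * r2)
      (fun x hx => by
        have h1 := ih x hx.le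
        have h2 := bI_nonneg (n+2) x hx.le
        push_cast at h2
        have : 0 ≤ besselI n x - besselI ((n:ℤ) + 1) x := by linarith
        positivity) (by simp) t ht
    have h := nonneg_of_mul_nonneg_right this (by positivity)
    push_cast
    rw [add_assoc]
    norm_num
    linarith

lemma bI_deriv_nat (n : ℕ) (t : ℝ) :
    t * ((besselI ((n:ℤ) + 1) t + besselI ((n:ℤ) - 1) t) / 2) = n * besselI n t + t * besselI ((n:ℤ)+1) t := by
  have := bI_rec n t
  push_cast at this
  linarith

lemma wronsk_const (t : ℝ) (ht : 0 < t) :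
    t * (besselI 0 t * besselK 1 t + besselI 1 t * besselK 0 t) =
      besselI 0 1 * besselK 1 1 + besselI 1 1 * besselK 0 1 := by
  have hd : ∀ x ∈ Set.Ioi (0:ℝ), HasDerivAt (fun t => t * (besselI 0 t * besselK 1 t + besselI 1 t * besselK 0 t)) 0 x := by
    intro x hx
    have hx : 0 < x := hx
    have h := (hasDerivAt_id x).mul (((bI_deriv 0 x).mul (bK_deriv 1 x hx)).add
      ((bI_deriv 1 x).mul (bK_deriv 0 x hx)))
    refine h.congr_deriv ?_
    have r1 := bI_rec 1 x
    have r2 := bK_rec 1 x hx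
    have n1 := bI_neg 1 x
    have n2 : besselK (-1) x = besselK 1 x := by simp [besselK, Real.cosh_neg]
    simp only [zero_add, zero_sub, sub_self, n1, n2, id, Pi.add_apply, Pi.mul_apply, one_mul] at *
    norm_num at *
    linear_combination (-besselI 0 x / 2) * r2 + (-besselK 0 x / 2) * r1
  have := (convex_Ioi (0:ℝ)).is_const_of_fderivWithin_eq_zero (𝕜 := ℝ)
    (f := fun t => t * (besselI 0 t * besselK 1 t + besselI 1 t * besselK 0 t))
    (fun x hx => (hd x hx).differentiableAt.differentiableWithinAt)
    (fun x hx => by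
      rw [fderivWithin_of_isOpen isOpen_Ioi hx]
      ext; simp [(hd x hx).deriv])
    ht (Set.mem_Ioi.2 one_pos)
  simpa using this

lemma wronsk_shift (n : ℕ) (t : ℝ) (ht : 0 < t) :
    t * (besselI n t * besselK ((n:ℤ)+1) t + besselI ((n:ℤ)+1) t * besselK n t) =
      besselI 0 1 * besselK 1 1 + besselI 1 1 * besselK 0 1 := by
  induction n with
  | zero => simpa using wronsk_const t ht
  | succ n ih =>
    rw [← ih]
    have r1 := bI_rec ((n:ℤ)+1) t
    have r2 := bK_rec ((n:ℤ)+1) t ht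
    have e3 : (n:ℤ) + 1 - 1 = n := by ring
    rw [e3] at r1 r2
    push_cast at *
    linear_combination besselI ((n:ℤ)+1) t * r2 - besselK ((n:ℤ)+1) t * r1

noncomputable def C0 : ℝ := besselI 0 1 * besselK 1 1 + besselI 1 1 * besselK 0 1

lemma C0_nonneg : 0 ≤ C0 := by
  have h0 := bI_nonneg 0 1 zero_le_one
  have h1 := bI_nonneg 1 1 zero_le_one
  have := bK_nonneg 1 1
  have := bK_nonneg 0 1
  simp only [Nat.cast_zero, Nat.cast_one] at h0 h1
  unfold C0; positivity

lemma IK_le (n : ℕ) (t : ℝ) (ht : 0 < t) : t * (besselI n t * besselK ((n:ℤ)+1) t) ≤ C0 := by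
  have := wronsk_shift n t ht
  have h1 := bI_nonneg (n+1) t ht.le
  have h2 := bK_nonneg n t
  push_cast at h1
  have : 0 ≤ t * (besselI ((n:ℤ)+1) t * besselK n t) := by positivity
  unfold C0; linarith

lemma bI_zero_mono (u t : ℝ) (hu : 0 ≤ u) (h : u ≤ t) : besselI 0 u ≤ besselI 0 t := by
  have hm : MonotoneOn (besselI 0) (Set.Ici 0) := by
    apply monotoneOn_of_deriv_nonneg (convex_Ici 0) (bI_cont 0).continuousOn
    · intro x _; exact (bI_deriv 0 x).differentiableAt.differentiableWithinAt
    · intro x hx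
      rw [interior_Ici] at hx
      rw [(bI_deriv 0 x).deriv]
      have := bI_nonneg 1 x (le_of_lt hx)
      have e := bI_neg 1 x
      simp only [zero_add, zero_sub]
      rw [e]; push_cast at this; linarith
  exact hm hu (hu.trans h) h

lemma bI_zero_zero : besselI 0 0 = 1 := by
  simp [besselI, Real.pi_ne_zero]

lemma intI_tool (n : ℤ) (F F' : ℝ → ℝ) (hF : ∀ x, HasDerivAt F (F' x) x) (s : ℝ) (hs : 0 ≤ s)
    (h : ∀ x, 0 < x → x * besselI n x ≤ F' x) (h0 : F 0 = 0) :
    ∫ t in (0:ℝ)..s, t * besselI n t ≤ F s := by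
  have hc := bI_cont n
  have := integral_le_sub_of_hasDeriv_right_of_le hs
    (continuous_iff_continuousAt.2 fun t => (hF t).continuousAt).continuousOn
    (fun x _ => (hF x).hasDerivWithinAt)
    (φ := fun t => t * besselI n t)
    ((by fun_prop : Continuous (fun t => t * besselI n t)).continuousOn.integrableOn_Icc)
    (fun x hx => h x hx.1)
  rwa [h0, sub_zero] at this

lemma A1 (n : ℕ) (s : ℝ) (hs : 0 ≤ s) : ∫ t in (0:ℝ)..s, t * besselI n t ≤ 2 * s * besselI n s := by
  rcases n with _ | k
  · have := intI_tool 0 (fun s => s * besselI 1 s) (fun s => s * besselI 0 s) (fun x => by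
      refine ((hasDerivAt_id x).mul (bI_deriv 1 x)).congr_deriv ?_
      have r1 := bI_rec 1 x
      simp only [id, one_mul, sub_self] at *
      push_cast at r1
      linarith) s hs (fun x hx => le_rfl) (by simp)
    have h2 := mul_le_mul_of_nonneg_left (bI_one_le s) hs
    have h3 := mul_nonneg hs (bI_zero_pos s).le
    simp only [Nat.cast_zero]
    linarith
  · refine intI_tool ((k+1:ℕ):ℤ) (fun s => 2 * s * besselI ((k+1:ℕ):ℤ) s)
      (fun x => 2 * besselI ((k+1:ℕ):ℤ) x + 2 * x * ((besselI (((k+1:ℕ):ℤ) + 1) x + besselI (((k+1:ℕ):ℤ) - 1) x) / 2))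
      (fun x => by
        refine (((hasDerivAt_id x).const_mul 2).mul (bI_deriv ((k+1:ℕ):ℤ) x)).congr_deriv ?_
        simp only [id, mul_one]) s hs (fun x hx => ?_) (by simp)
    have h1 := bI_nonneg (k+1) x hx.le
    have h2 := bI_nonneg (k+2) x hx.le
    have h3 := bI_anti k x hx.le
    push_cast at *
    rw [add_sub_cancel_right, add_assoc]
    norm_num
    nlinarith

lemma A2 (n : ℕ) (s : ℝ) (hs : 0 ≤ s) :
    ∫ t in (0:ℝ)..s, t * besselI n t ≤ s ^ 2 * besselI n s / (n + 2) := by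
  have hn : (0:ℝ) < n + 2 := by positivity
  refine intI_tool n (fun s => s ^ 2 * besselI n s / (n + 2))
      (fun x => (2 * x * besselI n x + x ^ 2 * ((besselI ((n:ℤ) + 1) x + besselI ((n:ℤ) - 1) x) / 2)) / (n + 2))
      (fun x => by
        refine (((hasDerivAt_pow 2 x).mul (bI_deriv n x)).div_const _).congr_deriv ?_
        simp) s hs (fun x hx => ?_) (by simp)
  rw [le_div_iff₀ hn]
  have h1 := bI_nonneg (n+1) x hx.le
  have h2 := bI_deriv_nat n x
  push_cast at h1
  have h3 : 0 ≤ x * x * besselI ((n:ℤ)+1) x := by positivity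
  rw [pow_two, mul_assoc x x, h2]
  linarith

lemma intK_tool (n : ℤ) (F F' : ℝ → ℝ) (t M : ℝ) (ht : 0 < t) (htM : t ≤ M)
    (hF : ∀ x, 0 < x → HasDerivAt F (F' x) x)
    (h : ∀ x, t ≤ x → F' x ≤ - (x * besselK n x)) (h0 : 0 ≤ F M) :
    ∫ s in t..M, s * besselK n s ≤ F t := by
  have hc : ContinuousOn (fun s => s * besselK n s) (Set.Icc t M) := fun x hx =>
    (continuousAt_id.mul (bK_deriv n x (ht.trans_le hx.1)).continuousAt).continuousWithinAt
  have := integral_le_sub_of_hasDeriv_right_of_le htM (g := fun x => - F x) (g' := fun x => - F' x)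
    (fun x hx => (hF x (ht.trans_le hx.1)).neg.continuousAt.continuousWithinAt)
    (fun x hx => (hF x (ht.trans hx.1)).neg.hasDerivWithinAt)
    (φ := fun t => t * besselK n t)
    hc.integrableOn_Icc
    (fun x hx => by linarith [h x hx.1.le])
  linarith

lemma K_d1 (n : ℕ) (x : ℝ) (hx : 0 < x) :
    -(besselK ((n:ℤ) + 1 + 1) x + besselK ((n:ℤ) + 1 - 1) x) / 2 ≤ - besselK ((n:ℤ)+1) x := by
  unfold besselK
  have := MeasureTheory.integral_add (K_int x hx ((n:ℤ) + 1 + 1 : ℤ)) (K_int x hx ((n:ℤ) + 1 - 1 : ℤ))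
  rw [← this]
  have : 2 * ∫ α in Set.Ioi (0:ℝ), Real.exp (-x * Real.cosh α) * Real.cosh ((((n:ℤ) + 1 : ℤ):ℝ) * α) ≤
    ∫ α in Set.Ioi (0:ℝ), (Real.exp (-x * Real.cosh α) * Real.cosh ((((n:ℤ) + 1 + 1 : ℤ):ℝ) * α) + Real.exp (-x * Real.cosh α) * Real.cosh ((((n:ℤ) + 1 - 1 : ℤ):ℝ) * α)) := by
    rw [← MeasureTheory.integral_const_mul]
    apply setIntegral_mono_on ((K_int x hx _).const_mul _) ((K_int x hx _).add (K_int x hx _)) measurableSet_Ioi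
    intro α hα
    have e : Real.cosh ((((n:ℤ) + 1 + 1 : ℤ):ℝ) * α) + Real.cosh ((((n:ℤ) + 1 - 1 : ℤ):ℝ) * α)
        = 2 * Real.cosh α * Real.cosh ((((n:ℤ) + 1 : ℤ):ℝ) * α) := by
      rw [Int.cast_add ((n:ℤ)+1), Int.cast_sub ((n:ℤ)+1)]
      simp only [Int.cast_one, add_mul _ (1:ℝ), sub_mul _ (1:ℝ), one_mul, Real.cosh_add, Real.cosh_sub]
      ring
    have h1 := Real.one_le_cosh α
    have h2 : 0 < Real.exp (-x * Real.cosh α) * Real.cosh ((((n:ℤ) + 1 : ℤ):ℝ) * α) := by positivity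
    simp only [Pi.add_apply]
    rw [← mul_add, e]
    nlinarith
  linarith

lemma K_d2 (n : ℕ) (x : ℝ) (hx : 0 < x) :
    x * (-(besselK ((n:ℤ) + 1 + 1) x + besselK ((n:ℤ) + 1 - 1) x) / 2) ≤ - ((n + 1) * besselK ((n:ℤ)+1) x) := by
  have h1 := bK_rec ((n:ℤ)+1) x hx
  have h2 := mul_nonneg hx.le (bK_nonneg ((n:ℤ)+1-1) x)
  push_cast at h1
  linarith

/-- n ≥ 1 -/
lemma B1 (n : ℕ) (hn : 1 ≤ n) (t M : ℝ) (ht : 0 < t) (htM : t ≤ M) :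
    ∫ s in t..M, s * besselK ((n:ℤ)+1) s ≤ 2 * t * besselK ((n:ℤ)+1) t := by
  refine intK_tool ((n:ℤ)+1) (fun s => 2 * s * besselK ((n:ℤ)+1) s)
    (fun x => 2 * besselK ((n:ℤ)+1) x + 2 * x * (-(besselK ((n:ℤ) + 1 + 1) x + besselK ((n:ℤ) + 1 - 1) x) / 2))
    t M ht htM (fun x hx => ?_) (fun x hx => ?_) ?_
  · refine (((hasDerivAt_id x).const_mul 2).mul (bK_deriv ((n:ℤ)+1) x hx)).congr_deriv ?_
    simp only [id, mul_one]
  · have hx := ht.trans_le hx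
    have h1 := mul_le_mul_of_nonneg_left (K_d1 n x hx) hx.le
    have h2 := K_d2 n x hx
    have h3 := bK_nonneg ((n:ℤ)+1) x
    have h4 : (1:ℝ) ≤ n := by exact_mod_cast hn
    nlinarith
  · have := bK_nonneg ((n:ℤ)+1) M
    have := ht.trans_le htM
    positivity

/-- n ≥ 2 -/
lemma B2 (n : ℕ) (hn : 2 ≤ n) (t M : ℝ) (ht : 0 < t) (htM : t ≤ M) :
    ∫ s in t..M, s * besselK ((n:ℤ)+1) s ≤ t ^ 2 * besselK ((n:ℤ)+1) t / (n - 1) := by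
  have h4 : (2:ℝ) ≤ n := by exact_mod_cast hn
  have h5 : (0:ℝ) < n - 1 := by linarith
  refine intK_tool ((n:ℤ)+1) (fun s => s ^ 2 * besselK ((n:ℤ)+1) s / (n - 1))
    (fun x => (2 * x * besselK ((n:ℤ)+1) x + x ^ 2 * (-(besselK ((n:ℤ) + 1 + 1) x + besselK ((n:ℤ) + 1 - 1) x) / 2)) / (n - 1))
    t M ht htM (fun x hx => ?_) (fun x hx => ?_) ?_
  · refine (((hasDerivAt_pow 2 x).mul (bK_deriv ((n:ℤ)+1) x hx)).div_const _).congr_deriv ?_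
    simp
  · have hx := ht.trans_le hx
    have h2 := mul_le_mul_of_nonneg_left (K_d2 n x hx) hx.le
    rw [div_le_iff₀ h5]
    nlinarith
  · have := bK_nonneg ((n:ℤ)+1) M
    have := ht.trans_le htM
    positivity

lemma B0 (t M : ℝ) (ht : 0 < t) (htM : t ≤ M) :
    ∫ s in t..M, s * besselK 1 s ≤ (t + 1) * besselK 1 t := by
  refine intK_tool 1 (fun s => (s + 1) * besselK 1 s)
    (fun x => besselK 1 x + (x + 1) * (-(besselK (1 + 1) x + besselK (1 - 1) x) / 2))
    t M ht htM (fun x hx => ?_) (fun x hx => ?_) ?_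
  · refine (((hasDerivAt_id x).add_const 1).mul (bK_deriv 1 x hx)).congr_deriv ?_
    simp only [id, one_mul]
  · have hx := ht.trans_le hx
    have h1 := mul_le_mul_of_nonneg_left (K_d1 0 x hx) (by linarith : 0 ≤ x + 1)
    simp only [Nat.cast_zero, zero_add] at h1
    linarith
  · have := bK_nonneg 1 M
    have := ht.trans_le htM
    positivity

lemma K1_le (s : ℝ) (hs : 0 < s) : s * besselK 1 s ≤ C0 := by
  have h := IK_le 0 s hs
  simp only [Nat.cast_zero, zero_add] at h
  have h1 := bI_zero_mono 0 s le_rfl hs.le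
  rw [bI_zero_zero] at h1
  have h2 := mul_nonneg hs.le (bK_nonneg 1 s)
  nlinarith

lemma K1_le' (s : ℝ) (hs : 0 ≤ s) : s * besselK 1 s ≤ 2 * C0 * Real.exp (-s / 2) := by
  rcases hs.eq_or_lt with rfl | hs
  · have := C0_nonneg
    simp; exact this
  have h1 := bK_exp 1 (s/2) s (half_pos hs) (by linarith)
  have h2 := K1_le (s/2) (half_pos hs)
  have e : -(s - s/2) = -s/2 := by ring
  rw [e] at h1
  have := Real.exp_pos (-s/2)
  calc s * besselK 1 s ≤ s * (Real.exp (-s/2) * besselK 1 (s/2)) := by gcongr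
    _ = 2 * (s / 2 * besselK 1 (s/2)) * Real.exp (-s/2) := by ring
    _ ≤ _ := by gcongr

lemma B00 (t M : ℝ) (ht : 0 ≤ t) (htM : t ≤ M) :
    ∫ s in t..M, s * besselK 1 s ≤ 4 * C0 := by
  have hC := C0_nonneg
  by_cases hi : IntervalIntegrable (fun s => s * besselK 1 s) volume t M
  · have h1 : ∫ s in t..M, s * besselK 1 s ≤ ∫ s in t..M, 2 * C0 * Real.exp (-s / 2) := by
      apply intervalIntegral.integral_mono_on htM hi
      · apply Continuous.intervalIntegrable; fun_prop
      · intro x hx; exact K1_le' x (ht.trans hx.1)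
    have h2 : ∫ s in t..M, 2 * C0 * Real.exp (-s / 2) =
        (-4 * C0 * Real.exp (-M/2)) - (-4 * C0 * Real.exp (-t/2)) := by
      apply intervalIntegral.integral_eq_sub_of_hasDerivAt (f := fun s => -4 * C0 * Real.exp (-s/2))
      · intro x _
        have := (((hasDerivAt_id x).neg.div_const 2).exp.const_mul (-4 * C0))
        refine this.congr_deriv ?_
        simp; ring
      · apply Continuous.intervalIntegrable; fun_prop
    have h3 : Real.exp (-t/2) ≤ 1 := Real.exp_le_one_iff.2 (by linarith)
    have h4 := Real.exp_pos (-M/2)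
    nlinarith
  · rw [intervalIntegral.integral_undef hi]; positivity

noncomputable def D0 : ℝ := 4 * C0 * besselI 0 1

lemma D0_ge : 4 * C0 ≤ D0 := by
  have h1 := bI_zero_mono 0 1 le_rfl zero_le_one
  rw [bI_zero_zero] at h1
  have := C0_nonneg
  unfold D0; nlinarith

lemma XB (n : ℕ) (t M : ℝ) (ht : 0 < t) (htM : t ≤ M) :
    besselI n t * ∫ s in t..M, s * besselK ((n:ℤ)+1) s ≤ D0 := by
  have hD := D0_ge
  have hC := C0_nonneg
  have hI := bI_nonneg n t ht.le
  have hIK := IK_le n t ht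
  rcases n with _ | k
  · simp only [Nat.cast_zero, zero_add] at *
    rcases le_total t 1 with h | h
    · calc besselI 0 t * ∫ s in t..M, s * besselK 1 s ≤ besselI 0 t * (4 * C0) := by
            gcongr; exact B00 t M ht.le htM
        _ ≤ besselI 0 1 * (4 * C0) := by
            gcongr; exact bI_zero_mono t 1 ht.le h
        _ = D0 := by unfold D0; ring
    · have h2 := mul_nonneg hI (bK_nonneg 1 t)
      calc besselI 0 t * ∫ s in t..M, s * besselK 1 s ≤ besselI 0 t * ((t + 1) * besselK 1 t) := by
            gcongr; exact B0 t M ht htM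
        _ ≤ D0 := by nlinarith
  · calc _ ≤ besselI ((k+1:ℕ):ℤ) t * (2 * t * besselK (((k+1:ℕ):ℤ)+1) t) := by
          gcongr; exact B1 (k+1) (by omega) t M ht htM
      _ ≤ D0 := by linarith

lemma XBn (n : ℕ) (t M : ℝ) (ht : 0 < t) (htM : t ≤ M) (hM : 1 ≤ M) :
    (besselI n t * ∫ s in t..M, s * besselK ((n:ℤ)+1) s) * n ≤ D0 * M := by
  have hD := D0_ge
  have hC := C0_nonneg
  have hI := bI_nonneg n t ht.le
  have hIK := IK_le n t ht
  have hX := XB n t M ht htM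
  rcases Nat.lt_or_ge n 2 with h | h
  · interval_cases n
    · simp only [Nat.cast_zero, mul_zero]; nlinarith
    · simp only [Nat.cast_one, mul_one] at *; nlinarith
  · have h4 : (2:ℝ) ≤ n := by exact_mod_cast h
    have h5 : (0:ℝ) < n - 1 := by linarith
    have h6 : besselI n t * ∫ s in t..M, s * besselK ((n:ℤ)+1) s ≤ C0 * t / (n - 1) := by
      calc _ ≤ besselI n t * (t ^ 2 * besselK ((n:ℤ)+1) t / (n - 1)) := by
            gcongr; exact B2 n h t M ht htM
        _ = (t * (besselI n t * besselK ((n:ℤ)+1) t)) * t / (n - 1) := by ring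
        _ ≤ _ := by gcongr
    have h7 : C0 * t / (n - 1) * n ≤ 2 * (C0 * t) := by
      rw [div_mul_eq_mul_div, div_le_iff₀ h5]
      have : 0 ≤ C0 * t := by positivity
      nlinarith
    calc _ ≤ C0 * t / (n - 1) * n := by gcongr
      _ ≤ 2 * (C0 * t) := h7
      _ ≤ D0 * M := by nlinarith

lemma natAbs_facts (n : ℤ) : besselI n = besselI (n.natAbs : ℤ) ∧
    ∀ s, 0 < s → besselK (n + 1) s ≤ besselK ((n.natAbs : ℤ) + 1) s := by
  constructor
  · funext t
    rcases Int.natAbs_eq n with h | h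
    · rw [← h]
    · conv_lhs => rw [h]
      exact bI_neg _ _
  · intro s hs
    apply bK_mono _ _ _ s hs
    have : |n + 1| ≤ |(n.natAbs : ℤ) + 1| := by
      rw [abs_of_nonneg (by positivity : (0:ℤ) ≤ (n.natAbs : ℤ) + 1), abs_le]
      omega
    exact_mod_cast this

lemma A_final (n : ℤ) (s M : ℝ) (hs : 0 ≤ s) (hsM : s ≤ M) :
    (besselK (n + 1) s * ∫ t in (0:ℝ)..s, t * besselI n t) * (1 + M + |(n:ℝ)|) ≤ 3 * D0 * M := by
  obtain ⟨hI, hK⟩ := natAbs_facts n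
  have hC := C0_nonneg
  have hD := D0_ge
  have hM := hs.trans hsM
  rcases hs.eq_or_lt with rfl | hs'
  · simp only [intervalIntegral.integral_same, mul_zero, zero_mul]
    have : 0 ≤ D0 := by linarith
    positivity
  have hn : |(n:ℝ)| = (n.natAbs : ℝ) := by
    rw [Nat.cast_natAbs, Int.cast_abs]
  rw [hn, hI]
  set k := n.natAbs
  have hK' := hK s hs'
  have hJ : 0 ≤ ∫ t in (0:ℝ)..s, t * besselI k t := by
    apply intervalIntegral.integral_nonneg hs
    intro u hu
    exact mul_nonneg hu.1 (bI_nonneg k u hu.1)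
  have hIK := IK_le k s hs'
  have hk0 := bK_nonneg ((k:ℤ)+1) s
  set J := ∫ t in (0:ℝ)..s, t * besselI k t
  have h0 : besselK (n+1) s * J ≤ besselK ((k:ℤ)+1) s * J := by gcongr
  have h1 : besselK ((k:ℤ)+1) s * J ≤ 2 * C0 := by
    calc _ ≤ besselK ((k:ℤ)+1) s * (2 * s * besselI k s) := by gcongr; exact A1 k s hs
      _ ≤ _ := by linarith
  have h2 : besselK ((k:ℤ)+1) s * J * (k + 2) ≤ C0 * s := by
    have hk : (0:ℝ) < k + 2 := by positivity
    rw [← le_div_iff₀ hk]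
    calc _ ≤ besselK ((k:ℤ)+1) s * (s ^ 2 * besselI k s / (k + 2)) := by gcongr; exact A2 k s hs
      _ = s * (besselI k s * besselK ((k:ℤ)+1) s) * s / (k + 2) := by ring
      _ ≤ _ := by gcongr
  have h3 : 0 ≤ besselK ((k:ℤ)+1) s * J := by positivity
  calc _ ≤ besselK ((k:ℤ)+1) s * J * (1 + M + k) := by gcongr
    _ ≤ 3 * D0 * M := by nlinarith [mul_le_mul_of_nonneg_right h1 hM, mul_le_mul_of_nonneg_left hsM hC, mul_le_mul_of_nonneg_right hD hM]

lemma B_final (n : ℤ) (t M : ℝ) (ht : 0 ≤ t) (htM : t ≤ M) (hM : 1 ≤ M) :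
    (besselI n t * ∫ s in t..M, s * besselK (n+1) s) * (1 + M + |(n:ℝ)|) ≤ 3 * D0 * M := by
  obtain ⟨hI, hK⟩ := natAbs_facts n
  have hC := C0_nonneg
  have hD := D0_ge
  have hD' : 0 ≤ D0 := by linarith
  have hn : |(n:ℝ)| = (n.natAbs : ℝ) := by
    rw [Nat.cast_natAbs, Int.cast_abs]
  rcases ht.eq_or_lt with rfl | ht'
  · by_cases h0 : n = 0
    · subst h0
      have := B00 0 M le_rfl htM
      simp only [zero_add, Int.cast_zero, abs_zero, add_zero, bI_zero_zero, one_mul]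
      nlinarith
    · rw [hI, bI_at_zero n.natAbs (by omega), zero_mul, zero_mul]
      positivity
  rw [hn, hI]
  set k := n.natAbs
  have hIk := bI_nonneg k t ht
  have h1 := XB k t M ht' htM
  have h2 := XBn k t M ht' htM hM
  have hint : ∀ j : ℤ, IntervalIntegrable (fun s => s * besselK j s) volume t M := by
    intro j
    apply ContinuousOn.intervalIntegrable
    rw [Set.uIcc_of_le htM]
    exact fun x hx =>
      (continuousAt_id.mul (bK_deriv j x (ht'.trans_le hx.1)).continuousAt).continuousWithinAt
  have h3 : ∫ s in t..M, s * besselK (n+1) s ≤ ∫ s in t..M, s * besselK ((k:ℤ)+1) s := by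
    apply intervalIntegral.integral_mono_on htM (hint _) (hint _)
    intro x hx
    have hx0 := ht'.trans_le hx.1
    exact mul_le_mul_of_nonneg_left (hK x hx0) hx0.le
  calc _ ≤ (besselI k t * ∫ s in t..M, s * besselK ((k:ℤ)+1) s) * (1 + M + k) := by gcongr
    _ ≤ 3 * D0 * M := by nlinarith

/-- There is a constant `C > 0` such that for all integers `m ≠ 0` and all integers `n`,
both `𝓘₁ = (1/|m|)·sup_{0 ≤ s ≤ |m|} K_{n+1}(s)·∫_0^s t·I_n(t) dt` and
`𝓘₂ = (1/|m|)·sup_{0 ≤ t ≤ |m|} I_n(t)·∫_t^{|m|} s·K_{n+1}(s) ds` are bounded by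
`C/√(1 + m² + n²)`. -/
theorem sup_bessel_integrals_le :
    ∃ C : ℝ, 0 < C ∧ ∀ m n : ℤ, m ≠ 0 →
      (1 / |(m : ℝ)|) *
          sSup ((fun s => besselK (n + 1) s * ∫ t in (0:ℝ)..s, t * besselI n t) ''
            Set.Icc (0:ℝ) |(m : ℝ)|)
        ≤ C / Real.sqrt (1 + (m : ℝ) ^ 2 + (n : ℝ) ^ 2) ∧
      (1 / |(m : ℝ)|) *
          sSup ((fun t => besselI n t * ∫ s in t..|(m : ℝ)|, s * besselK (n + 1) s) ''
            Set.Icc (0:ℝ) |(m : ℝ)|)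
        ≤ C / Real.sqrt (1 + (m : ℝ) ^ 2 + (n : ℝ) ^ 2) := by
  refine ⟨3 * D0 + 1, by linarith [D0_ge, C0_nonneg], fun m n hm => ?_⟩
  have hD' : 0 ≤ D0 := by linarith [D0_ge, C0_nonneg]
  have hM : (1:ℝ) ≤ |(m:ℝ)| := by
    exact_mod_cast Int.one_le_abs hm
  have hsq : Real.sqrt (1 + (m : ℝ) ^ 2 + (n : ℝ) ^ 2) ≤ 1 + |(m:ℝ)| + |(n:ℝ)| := by
    rw [Real.sqrt_le_left (by positivity), ← sq_abs (m:ℝ), ← sq_abs (n:ℝ)]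
    have := abs_nonneg (m:ℝ)
    have := abs_nonneg (n:ℝ)
    nlinarith [mul_nonneg (abs_nonneg (m:ℝ)) (abs_nonneg (n:ℝ))]
  have hsp : 0 < Real.sqrt (1 + (m : ℝ) ^ 2 + (n : ℝ) ^ 2) := by positivity
  set M := |(m:ℝ)|
  have hM0 : 0 < M := by linarith
  have hpos : 0 < 1 + M + |(n:ℝ)| := by positivity
  have fin : ∀ S : Set ℝ, (∀ x ∈ S, x * (1 + M + |(n:ℝ)|) ≤ 3 * D0 * M) →
      1 / M * sSup S ≤ (3 * D0 + 1) / Real.sqrt (1 + (m : ℝ) ^ 2 + (n : ℝ) ^ 2) := by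
    intro S hS
    have h1 : sSup S ≤ 3 * D0 * M / (1 + M + |(n:ℝ)|) := by
      apply Real.sSup_le
      · intro x hx
        rw [le_div_iff₀ hpos]; exact hS x hx
      · positivity
    calc 1 / M * sSup S ≤ 1 / M * (3 * D0 * M / (1 + M + |(n:ℝ)|)) := by gcongr
      _ = 3 * D0 / (1 + M + |(n:ℝ)|) := by field_simp
      _ ≤ (3 * D0 + 1) / (1 + M + |(n:ℝ)|) := by gcongr; linarith
      _ ≤ _ := by gcongr
  constructor
  · apply fin
    rintro _ ⟨s, hs, rfl⟩
    exact A_final n s M hs.1 hs.2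
  · apply fin
    rintro _ ⟨s, hs, rfl⟩
    exact B_final n s M hs.1 hs.2 hM
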